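/- Second-order expansion of the log-determinant near a diagonal matrix: Let Σ = D + A be a symmetric positive-definite n × n matrix, where D is the diagonal part (D_ii = Σ_ii > 0) and A is the off-diagonal part (A_ii = 0, A_ij = Σ_ij for i ≠ j). Then, as ‖A‖ → 0, log det Σ = Σ_i log Σ_ii − (1/2) Σ_{i ≠ j} (Σ_ij Σ_ji)/(Σ_ii Σ_jj) + O(‖A‖³); i.e. the log-determinant equals the sum of log-variances minus half the sum of squared normalized covariances up to third order in the off-diagonal entries. -/

import Mathlib

open Topology Finset

attribute [local instance] Matrix.seminormedAddCommGroup Matrix.normedAddCommGroup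

/-- The squared Frobenius norm of a real symmetric matrix is the sum of its squared eigenvalues. -/
theorem Matrix.IsHermitian.trace_mul_self_eq_sum_eigenvalues_sq {ι : Type*} [Fintype ι]
    [DecidableEq ι] {B : Matrix ι ι ℝ} (hB : B.IsHermitian) :
    (B * B).trace = ∑ i, hB.eigenvalues i ^ 2 := by
  have h : B * B = Unitary.conjStarAlgAut ℝ _ hB.eigenvectorUnitary
      (Matrix.diagonal fun i => hB.eigenvalues i ^ 2) := by
    conv_lhs => rw [hB.spectral_theorem]
    rw [← map_mul, Matrix.diagonal_mul_diagonal]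
    simp [sq]
  rw [h, Unitary.conjStarAlgAut_apply, Matrix.trace_mul_cycle]
  simp [Matrix.trace_diagonal]

theorem Matrix.IsHermitian.det_one_add_eq_prod {ι : Type*} [Fintype ι] [DecidableEq ι]
    {B : Matrix ι ι ℝ} (hB : B.IsHermitian) :
    (1 + B).det = ∏ i, (1 + hB.eigenvalues i) := by
  have h : 1 + B = Unitary.conjStarAlgAut ℝ _ hB.eigenvectorUnitary
      (Matrix.diagonal fun i => 1 + hB.eigenvalues i) := by
    conv_lhs => rw [hB.spectral_theorem,
      ← map_one (Unitary.conjStarAlgAut ℝ _ hB.eigenvectorUnitary), ← map_add,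
      ← Matrix.diagonal_one, Matrix.diagonal_add]
    simp
  rw [h, Unitary.conjStarAlgAut_apply, Matrix.det_mul_right_comm]
  simp

theorem Real.abs_log_one_add_sub_add_sq_le {x : ℝ} (hx : |x| ≤ 1 / 2) :
    |Real.log (1 + x) - x + x ^ 2 / 2| ≤ 2 * |x| ^ 3 := by
  have h := Real.abs_log_sub_add_sum_range_le (x := -x) (by rw [abs_neg]; linarith) 2
  rw [abs_neg] at h
  have e : (∑ i ∈ range 2, (-x) ^ (i + 1) / ((i : ℝ) + 1)) + Real.log (1 - -x)
      = Real.log (1 + x) - x + x ^ 2 / 2 := by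
    simp only [sum_range_succ, sum_range_zero, sub_neg_eq_add]
    norm_num
    ring
  rw [e] at h
  refine h.trans ?_
  rw [div_le_iff₀ (by linarith)]
  change |x| ^ 3 ≤ _
  nlinarith [mul_nonneg (pow_nonneg (abs_nonneg x) 3) (sub_nonneg.mpr hx)]

theorem Matrix.IsHermitian.abs_eigenvalues_le {ι : Type*} [Fintype ι] [DecidableEq ι]
    {B : Matrix ι ι ℝ} (hB : B.IsHermitian) {r : ℝ} (hr : 0 ≤ r)
    (htr : (B * B).trace ≤ r ^ 2) (i : ι) : |hB.eigenvalues i| ≤ r := by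
  rw [hB.trace_mul_self_eq_sum_eigenvalues_sq] at htr
  exact abs_le_of_sq_le_sq ((single_le_sum (f := fun i => hB.eigenvalues i ^ 2)
    (fun j _ => sq_nonneg _) (mem_univ i)).trans htr) hr

theorem Matrix.IsHermitian.det_one_add_pos {ι : Type*} [Fintype ι] [DecidableEq ι]
    {B : Matrix ι ι ℝ} (hB : B.IsHermitian) {r : ℝ} (hr : r < 1) (hr₀ : 0 ≤ r)
    (htr : (B * B).trace ≤ r ^ 2) : 0 < (1 + B).det := by
  rw [hB.det_one_add_eq_prod]
  refine prod_pos fun i _ => ?_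
  linarith [(abs_le.mp (hB.abs_eigenvalues_le hr₀ htr i)).1]

/-- Quantitative second-order expansion of `log det (1 + B)` for a small symmetric matrix `B`. -/
theorem Matrix.IsHermitian.abs_log_det_one_add_sub_le {ι : Type*} [Fintype ι] [DecidableEq ι]
    {B : Matrix ι ι ℝ} (hB : B.IsHermitian) {r : ℝ} (hr : r ≤ 1 / 2) (hr₀ : 0 ≤ r)
    (htr : (B * B).trace ≤ r ^ 2) :
    |Real.log (1 + B).det - B.trace + (B * B).trace / 2| ≤ 2 * r ^ 3 := by
  have hle := hB.abs_eigenvalues_le hr₀ htr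
  rw [hB.trace_mul_self_eq_sum_eigenvalues_sq] at htr ⊢
  have hpos (i : ι) : 1 + hB.eigenvalues i ≠ 0 := by
    have := (abs_le.mp (hle i)).1
    linarith
  rw [hB.det_one_add_eq_prod, Real.log_prod fun i _ => hpos i, hB.trace_eq_sum_eigenvalues,
    sum_div]
  simp only [RCLike.ofReal_real_eq_id, id]
  rw [← sum_sub_distrib, ← sum_add_distrib]
  calc _ ≤ ∑ i, |Real.log (1 + hB.eigenvalues i) - hB.eigenvalues i + hB.eigenvalues i ^ 2 / 2| :=
        abs_sum_le_sum_abs _ _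
    _ ≤ ∑ i, 2 * r * hB.eigenvalues i ^ 2 := by
        refine sum_le_sum fun i _ => ?_
        refine (Real.abs_log_one_add_sub_add_sq_le ((hle i).trans hr)).trans ?_
        rw [← sq_abs (hB.eigenvalues i)]
        nlinarith [mul_le_mul_of_nonneg_right (hle i) (sq_nonneg |hB.eigenvalues i|)]
    _ = 2 * r * ∑ i, hB.eigenvalues i ^ 2 := by rw [mul_sum]
    _ ≤ 2 * r * r ^ 2 := by gcongr
    _ = 2 * r ^ 3 := by ring

/-- **Second-order expansion of the log-determinant near a diagonal matrix.**
For a fixed positive diagonal part `D = diagonal d` (`d i = Σ_ii > 0`), and `A` the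
off-diagonal part (symmetric with zero diagonal, so that `Σ = D + A` is the symmetric
matrix with entries `Σ_ii = d i` and `Σ_ij = A i j` for `i ≠ j`), as `‖A‖ → 0`,

`log det Σ = ∑ i log Σ_ii − (1/2) ∑_{i ≠ j} Σ_ij Σ_ji / (Σ_ii Σ_jj) + O(‖A‖³)`.

The expansion is stated as a big-O bound along the filter of symmetric zero-diagonal
matrices `A` tending to `0`. -/
theorem logDet_expansion_near_diagonal {n : ℕ} (d : Fin n → ℝ) (hd : ∀ i, 0 < d i) :
    (fun A : Matrix (Fin n) (Fin n) ℝ =>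
        Real.log (Matrix.diagonal d + A).det
          - ((∑ i, Real.log (d i))
              - (1 / 2 : ℝ) * ∑ i, ∑ j ∈ Finset.univ.erase i,
                  A i j * A j i / (d i * d j)))
      =O[𝓝[{A : Matrix (Fin n) (Fin n) ℝ | A.IsSymm ∧ ∀ i, A i i = 0}] 0]
        (fun A : Matrix (Fin n) (Fin n) ℝ => ‖A‖ ^ 3) := by
  set s : Fin n → ℝ := fun i => √(d i)
  have hs (i : Fin n) : 0 < s i := Real.sqrt_pos.mpr (hd i)
  have hss (i : Fin n) : s i * s i = d i := Real.mul_self_sqrt (hd i).le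
  set K : ℝ := ∑ i, ∑ j, 1 / (d i * d j)
  have hK : 0 ≤ K := sum_nonneg fun i _ => sum_nonneg fun j _ =>
    one_div_nonneg.mpr (mul_pos (hd i) (hd j)).le
  have hsmall : ∀ᶠ A : Matrix (Fin n) (Fin n) ℝ in
      𝓝[{A | A.IsSymm ∧ ∀ i, A i i = 0}] 0, √K * ‖A‖ < 1 / 2 := by
    refine Filter.Eventually.filter_mono nhdsWithin_le_nhds ?_
    have hc : Continuous fun A : Matrix (Fin n) (Fin n) ℝ => √K * ‖A‖ :=
      continuous_const.mul continuous_norm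
    exact hc.tendsto 0 |>.eventually_lt_const (by simp)
  refine Asymptotics.IsBigO.of_bound (2 * √K ^ 3) ?_
  filter_upwards [hsmall, self_mem_nhdsWithin] with A hA ⟨hsymm, hdiag⟩
  set B : Matrix (Fin n) (Fin n) ℝ := Matrix.of fun i j => A i j / (s i * s j)
  have hB : B.IsHermitian := by
    ext i j
    simp [B, hsymm.apply i j, mul_comm]
  have hfactor : Matrix.diagonal d + A = Matrix.diagonal s * (1 + B) * Matrix.diagonal s := by
    ext i j
    have hi := (hs i).ne'
    have hj := (hs j).ne'
    rw [Matrix.mul_diagonal, Matrix.diagonal_mul, Matrix.add_apply, Matrix.add_apply]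
    by_cases hij : i = j
    · subst hij
      simp [B, hdiag, hss]
    · simp only [Matrix.diagonal_apply_ne _ hij, Matrix.one_apply_ne hij, B, Matrix.of_apply]
      field_simp
      ring
  have htrace : B.trace = 0 := by simp [Matrix.trace, B, hdiag]
  have hprod (i j : Fin n) : B i j * B j i = A i j * A j i / (d i * d j) := by
    simp only [B, Matrix.of_apply]
    rw [div_mul_div_comm, ← hss i, ← hss j]
    ring
  have hsq : (B * B).trace = ∑ i, ∑ j ∈ univ.erase i, A i j * A j i / (d i * d j) := by
    simp only [Matrix.trace, Matrix.diag_apply, Matrix.mul_apply, hprod]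
    refine sum_congr rfl fun i _ => (sum_erase _ ?_).symm
    simp [hdiag]
  have hle : (B * B).trace ≤ (√K * ‖A‖) ^ 2 := by
    simp only [Matrix.trace, Matrix.diag_apply, Matrix.mul_apply, hprod]
    rw [mul_pow, Real.sq_sqrt hK, sum_mul]
    refine sum_le_sum fun i _ => ?_
    rw [sum_mul]
    refine sum_le_sum fun j _ => ?_
    rw [one_div_mul_eq_div]
    refine div_le_div_of_nonneg_right ?_ (mul_pos (hd i) (hd j)).le
    rw [hsymm.apply i j, ← sq, ← sq_abs]
    exact pow_le_pow_left₀ (abs_nonneg _) (A.norm_entry_le_entrywise_sup_norm) 2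
  have hmain := hB.abs_log_det_one_add_sub_le hA.le (by positivity) hle
  have hdet : (1 + B).det ≠ 0 :=
    (hB.det_one_add_pos (by linarith) (by positivity) hle).ne'
  have hlog : Real.log (Matrix.diagonal d + A).det
      = (∑ i, Real.log (d i)) + Real.log (1 + B).det := by
    have hdet' : (Matrix.diagonal d + A).det = (∏ i, d i) * (1 + B).det := by
      rw [hfactor, Matrix.det_mul_right_comm, Matrix.diagonal_mul_diagonal, Matrix.det_mul,
        Matrix.det_diagonal]
      simp only [hss]
    rw [hdet', Real.log_mul (prod_ne_zero_iff.mpr fun i _ => (hd i).ne') hdet,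
      Real.log_prod fun i _ => (hd i).ne']
  rw [htrace, hsq, mul_pow] at hmain
  rw [hlog, Real.norm_eq_abs, Real.norm_of_nonneg (by positivity : (0 : ℝ) ≤ ‖A‖ ^ 3), mul_assoc]
  convert hmain using 2
  ring
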